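/- arXiv:0810.2214 — 3 statements merged into one kernel-verified Lean document; each statement's English description precedes it below -/
import Mathlib

section
/- For every even integer k with k > 4 and every integer m with m ≥ 3k/2, there exists a k-homogeneous Latin bitrade of volume k·m. -/
/-- A partial Latin square: a finite set of (row, column, entry) triples such that
no two distinct triples agree in (row, column), in (row, entry), or in (column, entry). -/
def IsPartialLatinSquare (T : Finset (ℕ × ℕ × ℕ)) : Prop :=
  (∀ x ∈ T, ∀ y ∈ T, x.1 = y.1 → x.2.1 = y.2.1 → x = y) ∧
  (∀ x ∈ T, ∀ y ∈ T, x.1 = y.1 → x.2.2 = y.2.2 → x = y) ∧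
  (∀ x ∈ T, ∀ y ∈ T, x.2.1 = y.2.1 → x.2.2 = y.2.2 → x = y)

/-- A Latin bitrade: a pair of disjoint partial Latin squares with the same filled
cells, the same entry set in each row, and the same entry set in each column. -/
def IsLatinBitrade (T T' : Finset (ℕ × ℕ × ℕ)) : Prop :=
  IsPartialLatinSquare T ∧ IsPartialLatinSquare T' ∧
  Disjoint T T' ∧
  (∀ r c, (∃ e, (r, c, e) ∈ T) ↔ (∃ e, (r, c, e) ∈ T')) ∧
  (∀ r e, (∃ c, (r, c, e) ∈ T) ↔ (∃ c, (r, c, e) ∈ T')) ∧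
  (∀ c e, (∃ r, (r, c, e) ∈ T) ↔ (∃ r, (r, c, e) ∈ T'))

/-- A Latin bitrade is k-homogeneous if each nonempty row and column of T contains
exactly k filled cells, and each entry value occurring in T occurs exactly k times. -/
def IsHomogeneousLatinBitrade (k : ℕ) (T T' : Finset (ℕ × ℕ × ℕ)) : Prop :=
  IsLatinBitrade T T' ∧
  (∀ r, (∃ x ∈ T, x.1 = r) → (T.filter (fun x => x.1 = r)).card = k) ∧
  (∀ c, (∃ x ∈ T, x.2.1 = c) → (T.filter (fun x => x.2.1 = c)).card = k) ∧
  (∀ e, (∃ x ∈ T, x.2.2 = e) → (T.filter (fun x => x.2.2 = e)).card = k)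

/-- A Latin bitrade (T, T') is primary if every nonempty Latin bitrade (U, U') with
U ⊆ T and U' ⊆ T' satisfies U = T and U' = T'. -/
def IsPrimaryLatinBitrade (T T' : Finset (ℕ × ℕ × ℕ)) : Prop :=
  IsLatinBitrade T T' ∧
  ∀ U U' : Finset (ℕ × ℕ × ℕ), IsLatinBitrade U U' → U.Nonempty →
    U ⊆ T → U' ⊆ T' → U = T ∧ U' = T'

/-- Cyclic construction: base rows indexed by `J`, columns `f`, entries `g`. -/
def cycT (m : ℕ) [NeZero m] (J : Finset ℤ) (f g : ℤ → ZMod m) : Finset (ℕ × ℕ × ℕ) :=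
  ((Finset.univ : Finset (ZMod m)) ×ˢ J).image
    (fun x => (x.1.val, (x.1 + f x.2).val, (x.1 + g x.2).val))

theorem mem_cycT {m : ℕ} [NeZero m] {J : Finset ℤ} {f g : ℤ → ZMod m} {x : ℕ × ℕ × ℕ} :
    x ∈ cycT m J f g ↔
      ∃ i : ZMod m, ∃ a ∈ J, x = (i.val, (i + f a).val, (i + g a).val) := by
  unfold cycT
  simp only [Finset.mem_image, Finset.mem_product, Finset.mem_univ, true_and, Prod.exists]
  constructor
  · rintro ⟨i, a, ha, rfl⟩; exact ⟨i, a, ha, rfl⟩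
  · rintro ⟨i, a, ha, rfl⟩; exact ⟨i, a, ha, rfl⟩

theorem val_inj' {m : ℕ} [NeZero m] {a b : ZMod m} : a.val = b.val ↔ a = b :=
  (ZMod.val_injective m).eq_iff

theorem cycT_pls {m : ℕ} [NeZero m] {J : Finset ℤ} {f g : ℤ → ZMod m}
    (hf : ∀ a ∈ J, ∀ b ∈ J, f a = f b → a = b)
    (hg : ∀ a ∈ J, ∀ b ∈ J, g a = g b → a = b)
    (hd : ∀ a ∈ J, ∀ b ∈ J, g a - f a = g b - f b → a = b) :
    IsPartialLatinSquare (cycT m J f g) := by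
  refine ⟨?_, ?_, ?_⟩
  · intro x hx y hy h1 h2
    obtain ⟨i, a, ha, rfl⟩ := mem_cycT.1 hx
    obtain ⟨j, b, hb, rfl⟩ := mem_cycT.1 hy
    simp only [val_inj'] at h1 h2
    subst h1
    rw [hf a ha b hb (add_left_cancel h2)]
  · intro x hx y hy h1 h2
    obtain ⟨i, a, ha, rfl⟩ := mem_cycT.1 hx
    obtain ⟨j, b, hb, rfl⟩ := mem_cycT.1 hy
    simp only [val_inj'] at h1 h2
    subst h1
    rw [hg a ha b hb (add_left_cancel h2)]
  · intro x hx y hy h1 h2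
    obtain ⟨i, a, ha, rfl⟩ := mem_cycT.1 hx
    obtain ⟨j, b, hb, rfl⟩ := mem_cycT.1 hy
    simp only [val_inj'] at h1 h2
    have := hd a ha b hb (by linear_combination h2 - h1)
    subst this
    rw [add_right_cancel h1]

theorem cycT_card_aux {m : ℕ} [NeZero m] {J : Finset ℤ} {f g : ℤ → ZMod m}
    (P : ℕ × ℕ × ℕ → Prop) [DecidablePred P] (s : ℤ → ZMod m)
    (hP : ∀ i : ZMod m, ∀ a ∈ J, P (i.val, (i + f a).val, (i + g a).val) ↔ i = s a)
    (hinj : ∀ a ∈ J, ∀ b ∈ J, s a = s b → s a + f a = s b + f b →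
      s a + g a = s b + g b → a = b) :
    ((cycT m J f g).filter P).card = J.card := by
  have : (cycT m J f g).filter P =
      J.image (fun a => ((s a).val, (s a + f a).val, (s a + g a).val)) := by
    ext x
    simp only [Finset.mem_filter, mem_cycT, Finset.mem_image]
    constructor
    · rintro ⟨⟨i, a, ha, rfl⟩, hx⟩
      have := (hP i a ha).1 hx
      subst this
      exact ⟨a, ha, rfl⟩
    · rintro ⟨a, ha, rfl⟩
      exact ⟨⟨s a, a, ha, rfl⟩, (hP (s a) a ha).2 rfl⟩
  rw [this, Finset.card_image_of_injOn]
  intro a ha b hb h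
  simp only [Prod.mk.injEq, val_inj'] at h
  exact hinj a ha b hb h.1 h.2.1 h.2.2

theorem cyc_main {m : ℕ} [NeZero m] {J : Finset ℤ} {f g : ℤ → ZMod m}
    (hf : ∀ a ∈ J, ∀ b ∈ J, f a = f b → a = b)
    (hg : ∀ a ∈ J, ∀ b ∈ J, g a = g b → a = b)
    (hd : ∀ a ∈ J, ∀ b ∈ J, g a - f a = g b - f b → a = b)
    (hfg : ∀ a ∈ J, ∃ b ∈ J, f a = g b)
    (hgf : ∀ a ∈ J, ∃ b ∈ J, g a = f b)
    (hn : ∀ a ∈ J, ∃ b ∈ J, g b - f b = f a - g a)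
    (h2 : ∀ a ∈ J, ∀ b ∈ J, f a = g b → g a = f b → False) :
    IsHomogeneousLatinBitrade J.card (cycT m J f g) (cycT m J g f) ∧
      (cycT m J f g).card = J.card * m := by
  refine ⟨⟨⟨cycT_pls hf hg hd, cycT_pls hg hf ?_, ?_, ?_, ?_, ?_⟩, ?_, ?_, ?_⟩, ?_⟩
  · intro a ha b hb h
    exact hd a ha b hb (by linear_combination -h)
  · rw [Finset.disjoint_left]
    intro x hx hy
    obtain ⟨i, a, ha, rfl⟩ := mem_cycT.1 hx
    obtain ⟨j, b, hb, h⟩ := mem_cycT.1 hy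
    simp only [Prod.mk.injEq, val_inj'] at h
    obtain ⟨rfl, h3, h4⟩ := h
    exact h2 a ha b hb (add_left_cancel h3) (add_left_cancel h4)
  · intro r c
    simp only [mem_cycT, Prod.mk.injEq]
    constructor
    · rintro ⟨e, i, a, ha, rfl, rfl, rfl⟩
      obtain ⟨b, hb, h⟩ := hfg a ha
      exact ⟨_, i, b, hb, rfl, by rw [h], rfl⟩
    · rintro ⟨e, i, a, ha, rfl, rfl, rfl⟩
      obtain ⟨b, hb, h⟩ := hgf a ha
      exact ⟨_, i, b, hb, rfl, by rw [h], rfl⟩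
  · intro r c
    simp only [mem_cycT, Prod.mk.injEq]
    constructor
    · rintro ⟨e, i, a, ha, rfl, rfl, rfl⟩
      obtain ⟨b, hb, h⟩ := hgf a ha
      exact ⟨_, i, b, hb, rfl, rfl, by rw [h]⟩
    · rintro ⟨e, i, a, ha, rfl, rfl, rfl⟩
      obtain ⟨b, hb, h⟩ := hfg a ha
      exact ⟨_, i, b, hb, rfl, rfl, by rw [h]⟩
  · intro c e
    simp only [mem_cycT, Prod.mk.injEq]
    constructor
    · rintro ⟨r, i, a, ha, rfl, rfl, rfl⟩
      obtain ⟨b, hb, h⟩ := hn a ha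
      refine ⟨_, i + f a - g b, b, hb, rfl, ?_, ?_⟩ <;> congr 1
      · ring
      · linear_combination h
    · rintro ⟨r, i, a, ha, rfl, rfl, rfl⟩
      obtain ⟨b, hb, h⟩ := hn a ha
      refine ⟨_, i + g a - f b, b, hb, rfl, ?_, ?_⟩ <;> congr 1
      · ring
      · linear_combination -h
  · rintro r ⟨x, hx, rfl⟩
    obtain ⟨i, a, ha, rfl⟩ := mem_cycT.1 hx
    refine cycT_card_aux _ (fun _ => i) ?_ ?_
    · intro j b hb
      simp only [val_inj']
    · intro a ha b hb _ h _
      exact hf a ha b hb (add_left_cancel h)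
  · rintro r ⟨x, hx, rfl⟩
    obtain ⟨i, a, ha, rfl⟩ := mem_cycT.1 hx
    refine cycT_card_aux _ (fun b => i + f a - f b) ?_ ?_
    · intro j b hb
      simp only [val_inj']
      exact eq_sub_iff_add_eq.symm
    · intro a ha b hb h _ _
      exact hf a ha b hb (by linear_combination -h)
  · rintro r ⟨x, hx, rfl⟩
    obtain ⟨i, a, ha, rfl⟩ := mem_cycT.1 hx
    refine cycT_card_aux _ (fun b => i + g a - g b) ?_ ?_
    · intro j b hb
      simp only [val_inj']
      exact eq_sub_iff_add_eq.symm
    · intro a ha b hb h _ _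
      exact hg a ha b hb (by linear_combination -h)
  · unfold cycT
    rw [Finset.card_image_of_injOn, Finset.card_product, Finset.card_univ, ZMod.card, mul_comm]
    rintro ⟨i, a⟩ hx ⟨j, b⟩ hy h
    simp only [Finset.coe_product, Set.mem_prod, Finset.mem_coe] at hx hy
    simp only [Prod.mk.injEq, val_inj'] at h
    obtain ⟨rfl, h3, h4⟩ := h
    rw [hf a hx.2 b hy.2 (add_left_cancel h3)]

theorem cast_eq_small {m : ℕ} {a b : ℤ} (h : (a : ZMod m) = b) (h1 : a - b < m)
    (h2 : b - a < m) : a = b := by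
  rw [ZMod.intCast_eq_intCast_iff_dvd_sub] at h
  have := Int.eq_zero_of_abs_lt_dvd h (by rw [abs_lt]; constructor <;> linarith)
  linarith

theorem int_main {m : ℕ} (hm : 0 < m) (J : Finset ℤ) (p : ℤ → ℤ)
    (hp : ∀ a ∈ J, p a ∈ J)
    (hinj : ∀ a ∈ J, ∀ b ∈ J, p a = p b → a = b)
    (hd : ∀ a ∈ J, ∀ b ∈ J, p a - a = p b - b → a = b)
    (hn : ∀ a ∈ J, ∃ b ∈ J, p b - b = a - p a)
    (h2 : ∀ a ∈ J, p (p a) ≠ a)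
    (hr : ∀ a ∈ J, ∀ b ∈ J, a - b < m)
    (hdr : ∀ a ∈ J, ∀ b ∈ J, (p a - a) - (p b - b) < m) :
    ∃ T T' : Finset (ℕ × ℕ × ℕ),
      IsHomogeneousLatinBitrade J.card T T' ∧ T.card = J.card * m := by
  have : NeZero m := ⟨hm.ne'⟩
  refine ⟨_, _, cyc_main (m := m) (J := J) (f := fun a => (a : ZMod m))
    (g := fun a => (p a : ZMod m)) ?_ ?_ ?_ ?_ ?_ ?_ ?_⟩
  · intro a ha b hb h
    exact cast_eq_small h (hr a ha b hb) (hr b hb a ha)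
  · intro a ha b hb h
    exact hinj a ha b hb
      (cast_eq_small h (hr _ (hp a ha) _ (hp b hb)) (hr _ (hp b hb) _ (hp a ha)))
  · intro a ha b hb h
    refine hd a ha b hb (cast_eq_small (m := m) ?_ (hdr a ha b hb) (hdr b hb a ha))
    push_cast
    exact h
  · intro a ha
    obtain ⟨b, hb, h⟩ := Finset.surj_on_of_inj_on_of_card_le (s := J) (t := J)
      (fun a _ => p a) hp (fun a b ha hb h => hinj a ha b hb h) le_rfl a ha
    exact ⟨b, hb, by simp only [h]⟩
  · intro a ha
    exact ⟨p a, hp a ha, rfl⟩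
  · intro a ha
    obtain ⟨b, hb, h⟩ := hn a ha
    refine ⟨b, hb, ?_⟩
    exact_mod_cast congrArg (fun z : ℤ => (z : ZMod m)) h
  · intro a ha b hb h h'
    have e1 := cast_eq_small h (hr _ ha _ (hp b hb)) (hr _ (hp b hb) _ ha)
    have e2 := cast_eq_small h' (hr _ (hp a ha) _ hb) (hr _ hb _ (hp a ha))
    exact h2 a ha (by rw [e2, e1])

/-- Doubling modulo `2h+1` on `1..2h`. -/
def dbl (h : ℤ) (a : ℤ) : ℤ := if a ≤ h then 2 * a else 2 * a - (2 * h + 1)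

/-- Doubling modulo `2h+1` with two extra points `0`, `2h+1` spliced in. -/
def dbl2 (h d : ℤ) (a : ℤ) : ℤ :=
  if a = 0 then 2 * d else if a = 2 * h + 1 then 2 * h + 1 - 2 * d
  else if a = d then 0 else if a = 2 * h + 1 - d then 2 * h + 1
  else if a ≤ h then 2 * a else 2 * a - (2 * h + 1)

theorem dbl2_spec (h d a : ℤ) :
    (a = 0 ∧ dbl2 h d a = 2 * d) ∨ (a = 2 * h + 1 ∧ dbl2 h d a = 2 * h + 1 - 2 * d) ∨
    (a = d ∧ dbl2 h d a = 0) ∨ (a = 2 * h + 1 - d ∧ dbl2 h d a = 2 * h + 1) ∨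
    (a ≠ 0 ∧ a ≠ d ∧ a ≤ h ∧ dbl2 h d a = 2 * a) ∨
    (a ≠ 2 * h + 1 ∧ a ≠ 2 * h + 1 - d ∧ h < a ∧ dbl2 h d a = 2 * a - (2 * h + 1)) := by
  unfold dbl2; split_ifs <;> omega

set_option maxHeartbeats 4000000 in
theorem stmt_2 (k m : ℕ) (hk : Even k) (hk4 : 4 < k) (hm : 3 * k ≤ 2 * m) :
    ∃ T T' : Finset (ℕ × ℕ × ℕ),
      IsHomogeneousLatinBitrade k T T' ∧ T.card = k * m := by
  obtain ⟨h, rfl⟩ := hk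
  by_cases h3 : (2 * h + 1) % 3 = 0
  · obtain ⟨n, hn⟩ : ∃ n : ℤ, n = h - 1 := ⟨_, rfl⟩
    obtain ⟨d, hd⟩ : ∃ d : ℤ, d = (n + 2) / 2 := ⟨_, rfl⟩
    have key := int_main (m := m) (by omega) (Finset.Icc (0 : ℤ) (2 * n + 1)) (dbl2 n d)
    have hc : (Finset.Icc (0 : ℤ) (2 * n + 1)).card = h + h := by
      rw [Int.card_Icc]; omega
    rw [hc] at key
    simp only [Finset.mem_Icc] at key
    apply key
    · intro a ha; unfold dbl2; split_ifs <;> omega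
    · intro a ha b hb; unfold dbl2; split_ifs <;> omega
    · intro a ha b hb; unfold dbl2; split_ifs <;> omega
    · intro a ha
      refine ⟨2 * n + 1 - a, by omega, ?_⟩
      unfold dbl2; split_ifs <;> omega
    · intro a ha
      have h1 := dbl2_spec n d a
      have h2 := dbl2_spec n d (dbl2 n d a)
      rcases h1 with h1 | h1 | h1 | h1 | h1 | h1 <;>
        rcases h2 with h2 | h2 | h2 | h2 | h2 | h2 <;> omega
    · intro a ha b hb; omega
    · intro a ha b hb
      have bd : ∀ a : ℤ, 0 ≤ a ∧ a ≤ 2 * n + 1 →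
          dbl2 n d a - a ≤ n + 2 ∧ -(n + 2) ≤ dbl2 n d a - a := by
        intro a ha
        unfold dbl2; split_ifs <;> omega
      have := bd a ha
      have := bd b hb
      omega
  · have key := int_main (m := m) (by omega) (Finset.Icc (1 : ℤ) (2 * h)) (dbl h)
    have hc : (Finset.Icc (1 : ℤ) (2 * h)).card = h + h := by
      rw [Int.card_Icc]; omega
    rw [hc] at key
    simp only [Finset.mem_Icc] at key
    apply key
    · intro a ha; unfold dbl; split_ifs <;> omega
    · intro a ha b hb; unfold dbl; split_ifs <;> omega
    · intro a ha b hb; unfold dbl; split_ifs <;> omega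
    · intro a ha
      refine ⟨2 * h + 1 - a, by omega, ?_⟩
      unfold dbl; split_ifs <;> omega
    · intro a ha
      unfold dbl; split_ifs <;> omega
    · intro a ha b hb; omega
    · intro a ha b hb; unfold dbl; split_ifs <;> omega
end

section
/- For every integer k with k ≥ 3, there exists a k-homogeneous Latin bitrade of volume k·(k+2), and there exists a k-homogeneous Latin bitrade of volume k·(k+4). -/
/-- The circulant family attached to a base row with columns `c` and entries `a` in `ZMod m`. -/
def circ {m k : ℕ} (c a : Fin k → ZMod m) (p : ZMod m × Fin k) : ℕ × ℕ × ℕ :=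
  (p.1.val, (c p.2 - p.1).val, (a p.2 + p.1).val)

/-- The set of triples of the circulant family. -/
def circSet {m k : ℕ} [NeZero m] (c a : Fin k → ZMod m) : Finset (ℕ × ℕ × ℕ) :=
  Finset.univ.image (circ c a)

theorem mem_circSet {m k : ℕ} [NeZero m] (c a : Fin k → ZMod m) (r y z : ℕ) :
    (r, y, z) ∈ circSet c a ↔ ∃ (s : ZMod m) (i : Fin k),
      s.val = r ∧ (c i - s).val = y ∧ (a i + s).val = z := by
  simp [circSet, circ]

theorem circSet_pls {m k : ℕ} [NeZero m] (c a : Fin k → ZMod m)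
    (hc : Function.Injective c) (ha : Function.Injective a)
    (hs : Function.Injective (fun i => c i + a i)) : IsPartialLatinSquare (circSet c a) := by
  have hv := ZMod.val_injective m
  refine ⟨?_, ?_, ?_⟩
  · rintro ⟨r, y, z⟩ hx ⟨r', y', z'⟩ hx' h1 h2
    obtain ⟨s, i, rfl, rfl, rfl⟩ := (mem_circSet c a _ _ _).1 hx
    obtain ⟨s', i', rfl, rfl, rfl⟩ := (mem_circSet c a _ _ _).1 hx'
    have e1 : s = s' := hv h1
    have e2 : c i - s = c i' - s' := hv h2
    subst e1
    have : i = i' := hc (by linear_combination e2)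
    rw [this]
  · rintro ⟨r, y, z⟩ hx ⟨r', y', z'⟩ hx' h1 h2
    obtain ⟨s, i, rfl, rfl, rfl⟩ := (mem_circSet c a _ _ _).1 hx
    obtain ⟨s', i', rfl, rfl, rfl⟩ := (mem_circSet c a _ _ _).1 hx'
    have e1 : s = s' := hv h1
    have e2 : a i + s = a i' + s' := hv h2
    subst e1
    have : i = i' := ha (by linear_combination e2)
    rw [this]
  · rintro ⟨r, y, z⟩ hx ⟨r', y', z'⟩ hx' h1 h2
    obtain ⟨s, i, rfl, rfl, rfl⟩ := (mem_circSet c a _ _ _).1 hx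
    obtain ⟨s', i', rfl, rfl, rfl⟩ := (mem_circSet c a _ _ _).1 hx'
    have e1 : c i - s = c i' - s' := hv h1
    have e2 : a i + s = a i' + s' := hv h2
    have : i = i' := hs (show c i + a i = c i' + a i' by linear_combination e1 + e2)
    subst this
    have : s = s' := by linear_combination e2
    rw [this]

theorem circ_injective {m k : ℕ} [NeZero m] (c a : Fin k → ZMod m)
    (hc : Function.Injective c) : Function.Injective (circ c a) := by
  rintro ⟨s, i⟩ ⟨s', i'⟩ h
  simp only [circ, Prod.mk.injEq] at h
  have hv := ZMod.val_injective m
  have e1 : s = s' := hv h.1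
  have e2 : c i - s = c i' - s' := hv h.2.1
  subst e1
  have : i = i' := hc (by linear_combination e2)
  rw [this]

theorem circSet_fiber {m k : ℕ} [NeZero m] (c a : Fin k → ZMod m)
    (hc : Function.Injective c) (P : ℕ × ℕ × ℕ → Prop) [DecidablePred P]
    (g : Fin k → ZMod m) (hg : ∀ s i, P (circ c a (s, i)) ↔ s = g i) :
    ((circSet c a).filter P).card = k := by
  have : (circSet c a).filter P = Finset.univ.image (fun i => circ c a (g i, i)) := by
    ext x
    simp only [circSet, Finset.mem_filter, Finset.mem_image, Finset.mem_univ, true_and]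
    constructor
    · rintro ⟨⟨⟨s, i⟩, rfl⟩, h⟩
      exact ⟨i, by rw [(hg s i).1 h]⟩
    · rintro ⟨i, rfl⟩
      exact ⟨⟨_, rfl⟩, (hg _ i).2 rfl⟩
  rw [this, Finset.card_image_of_injective, Finset.card_univ, Fintype.card_fin]
  intro i j h
  have := circ_injective c a hc h
  simp only [Prod.mk.injEq] at this
  exact this.2

theorem circ_bitrade {m k : ℕ} [NeZero m] (c a b : Fin k → ZMod m)
    (hc : Function.Injective c) (ha : Function.Injective a) (hb : Function.Injective b)
    (hsa : Function.Injective (fun i => c i + a i))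
    (hsb : Function.Injective (fun i => c i + b i))
    (hne : ∀ i, a i ≠ b i)
    (hE : ∀ i, ∃ j, b j = a i) (hD : ∀ i, ∃ j, c j + b j = c i + a i) :
    IsHomogeneousLatinBitrade k (circSet c a) (circSet c b) ∧
      (circSet c a).card = k * m := by
  have hv := ZMod.val_injective m
  have hE' : ∀ i, ∃ j, a j = b i := by
    choose σ hσ using hE
    have : Function.Injective σ := fun i j h => ha (by rw [← hσ, ← hσ, h])
    intro i
    obtain ⟨j, rfl⟩ := (Finite.injective_iff_surjective.1 this) i
    exact ⟨j, (hσ j).symm⟩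
  have hD' : ∀ i, ∃ j, c j + a j = c i + b i := by
    choose σ hσ using hD
    have : Function.Injective σ :=
      fun i j h => hsa (show c i + a i = c j + a j by rw [← hσ, ← hσ, h])
    intro i
    obtain ⟨j, rfl⟩ := (Finite.injective_iff_surjective.1 this) i
    exact ⟨j, (hσ j).symm⟩
  refine ⟨⟨⟨circSet_pls c a hc ha hsa, circSet_pls c b hc hb hsb, ?_, ?_, ?_, ?_⟩, ?_, ?_, ?_⟩, ?_⟩
  · rw [Finset.disjoint_left]
    rintro ⟨r, y, z⟩ hx hx'
    obtain ⟨s, i, rfl, rfl, rfl⟩ := (mem_circSet c a _ _ _).1 hx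
    obtain ⟨s', i', h1, h2, h3⟩ := (mem_circSet c b _ _ _).1 hx'
    have e1 := hv h1
    have e2 := hv h2
    have e3 := hv h3
    subst e1
    have : i' = i := hc (by linear_combination e2)
    subst this
    exact hne i' (by linear_combination -e3)
  · intro r y
    simp only [mem_circSet]
    constructor
    · rintro ⟨e, s, i, h1, h2, -⟩
      exact ⟨_, s, i, h1, h2, rfl⟩
    · rintro ⟨e, s, i, h1, h2, -⟩
      exact ⟨_, s, i, h1, h2, rfl⟩
  · intro r y
    simp only [mem_circSet]
    constructor
    · rintro ⟨e, s, i, h1, -, h2⟩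
      obtain ⟨j, hj⟩ := hE i
      exact ⟨_, s, j, h1, rfl, by rw [hj, h2]⟩
    · rintro ⟨e, s, i, h1, -, h2⟩
      obtain ⟨j, hj⟩ := hE' i
      exact ⟨_, s, j, h1, rfl, by rw [hj, h2]⟩
  · intro y z
    simp only [mem_circSet]
    constructor
    · rintro ⟨e, s, i, -, h1, h2⟩
      obtain ⟨j, hj⟩ := hD i
      refine ⟨_, c j - c i + s, j, rfl, ?_, ?_⟩
      · rw [← h1]; congr 1; ring
      · rw [← h2]; congr 1; linear_combination hj
    · rintro ⟨e, s, i, -, h1, h2⟩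
      obtain ⟨j, hj⟩ := hD' i
      refine ⟨_, c j - c i + s, j, rfl, ?_, ?_⟩
      · rw [← h1]; congr 1; ring
      · rw [← h2]; congr 1; linear_combination hj
  · rintro r ⟨x, hx, rfl⟩
    obtain ⟨⟨s, i⟩, -, rfl⟩ := Finset.mem_image.1 hx
    refine circSet_fiber c a hc _ (fun _ => s) ?_
    intro t j
    exact hv.eq_iff
  · rintro r ⟨x, hx, rfl⟩
    obtain ⟨⟨s, i⟩, -, rfl⟩ := Finset.mem_image.1 hx
    refine circSet_fiber c a hc _ (fun j => c j - (c i - s)) ?_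
    intro t j
    refine hv.eq_iff.trans ⟨fun h => ?_, fun h => ?_⟩
    · simp only at h; linear_combination -h
    · simp only; linear_combination -h
  · rintro r ⟨x, hx, rfl⟩
    obtain ⟨⟨s, i⟩, -, rfl⟩ := Finset.mem_image.1 hx
    refine circSet_fiber c a hc _ (fun j => (a i + s) - a j) ?_
    intro t j
    refine hv.eq_iff.trans ⟨fun h => ?_, fun h => ?_⟩
    · simp only at h; linear_combination h
    · simp only; linear_combination h
  · rw [circSet, Finset.card_image_of_injective _ (circ_injective c a hc), Finset.card_univ,
      Fintype.card_prod, ZMod.card, Fintype.card_fin, mul_comm]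

theorem window_eq {m lo x y : ℕ} (hx : lo ≤ x) (hx' : x < lo + m) (hy : lo ≤ y)
    (hy' : y < lo + m) (h : (x : ZMod m) = (y : ZMod m)) : x = y := by
  rw [ZMod.natCast_eq_natCast_iff, Nat.modEq_iff_dvd] at h
  have := Int.eq_zero_of_abs_lt_dvd h (by rw [abs_lt]; constructor <;> omega)
  omega

/-- A numerical base row gives a homogeneous bitrade. -/
theorem bitrade_of_base (m k lo : ℕ) (A B : ℕ → ℕ) (hk : 0 < k) (hkm : k ≤ m)
    (hA : ∀ i < k, A i < m) (hB : ∀ i < k, B i < m)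
    (hAi : ∀ i < k, ∀ j < k, A i = A j → i = j)
    (hBi : ∀ i < k, ∀ j < k, B i = B j → i = j)
    (hSA : ∀ i < k, lo ≤ i + A i ∧ i + A i < lo + m)
    (hSB : ∀ i < k, lo ≤ i + B i ∧ i + B i < lo + m)
    (hSAi : ∀ i < k, ∀ j < k, i + A i = j + A j → i = j)
    (hSBi : ∀ i < k, ∀ j < k, i + B i = j + B j → i = j)
    (hne : ∀ i < k, A i ≠ B i)
    (hE : ∀ i < k, ∃ j < k, B j = A i)
    (hD : ∀ i < k, ∃ j < k, j + B j = i + A i) :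
    ∃ T T' : Finset (ℕ × ℕ × ℕ), IsHomogeneousLatinBitrade k T T' ∧ T.card = k * m := by
  have : NeZero m := ⟨by omega⟩
  refine ⟨_, _, circ_bitrade (m := m) (k := k) (fun i => ((i : ℕ) : ZMod m))
    (fun i => (A i : ZMod m)) (fun i => (B i : ZMod m)) ?_ ?_ ?_ ?_ ?_ ?_ ?_ ?_⟩
  · intro i j h
    exact Fin.ext (window_eq (lo := 0) (by omega) (by omega) (by omega) (by omega) h)
  · intro i j h
    have h1 := hA i i.2
    have h2 := hA j j.2
    exact Fin.ext (hAi i i.2 j j.2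
      (window_eq (lo := 0) (by omega) (by omega) (by omega) (by omega) h))
  · intro i j h
    have h1 := hB i i.2
    have h2 := hB j j.2
    exact Fin.ext (hBi i i.2 j j.2
      (window_eq (lo := 0) (by omega) (by omega) (by omega) (by omega) h))
  · intro i j h
    have h1 := hSA i i.2
    have h2 := hSA j j.2
    exact Fin.ext (hSAi i i.2 j j.2
      (window_eq (m := m) h1.1 h1.2 h2.1 h2.2 (by push_cast; exact h)))
  · intro i j h
    have h1 := hSB i i.2
    have h2 := hSB j j.2
    exact Fin.ext (hSBi i i.2 j j.2
      (window_eq (m := m) h1.1 h1.2 h2.1 h2.2 (by push_cast; exact h)))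
  · intro i h
    have h1 := hA i i.2
    have h2 := hB i i.2
    exact hne i i.2 (window_eq (lo := 0) (by omega) (by omega) (by omega) (by omega) h)
  · intro i
    obtain ⟨j, hj, h⟩ := hE i i.2
    exact ⟨⟨j, hj⟩, by simp only [h]⟩
  · intro i
    obtain ⟨j, hj, h⟩ := hD i i.2
    exact ⟨⟨j, hj⟩, by simp only; exact_mod_cast congrArg (Nat.cast : ℕ → ZMod m) h⟩

theorem odd_case (n m : ℕ) (hn : 1 ≤ n) (hm : 2 * n + 1 ≤ m) :
    ∃ T T' : Finset (ℕ × ℕ × ℕ),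
      IsHomogeneousLatinBitrade (2 * n + 1) T T' ∧ T.card = (2 * n + 1) * m := by
  refine bitrade_of_base m (2 * n + 1) n
    (fun i => if i ≤ n then 2 * n - 2 * i else 4 * n + 1 - 2 * i)
    (fun i => if i < n then 2 * n - 1 - 2 * i else 4 * n - 2 * i)
    (by omega) hm ?_ ?_ ?_ ?_ ?_ ?_ ?_ ?_ ?_ ?_ ?_
  · intro i hi; split_ifs <;> omega
  · intro i hi; split_ifs <;> omega
  · intro i hi j hj; split_ifs <;> omega
  · intro i hi j hj; split_ifs <;> omega
  · intro i hi; split_ifs <;> omega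
  · intro i hi; split_ifs <;> omega
  · intro i hi j hj; split_ifs <;> omega
  · intro i hi j hj; split_ifs <;> omega
  · intro i hi; split_ifs <;> omega
  · intro i hi
    refine ⟨if i ≤ n then n + i else i - n - 1, ?_, ?_⟩ <;> split_ifs <;> omega
  · intro i hi
    refine ⟨if i = 0 then 2 * n else i - 1, ?_, ?_⟩ <;> split_ifs <;> omega

theorem even_case (n m : ℕ) (hn : 2 ≤ n) (hm : 2 * n + 2 ≤ m) :
    ∃ T T' : Finset (ℕ × ℕ × ℕ),
      IsHomogeneousLatinBitrade (2 * n) T T' ∧ T.card = (2 * n) * m := by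
  refine bitrade_of_base m (2 * n) n
    (fun i => if i = 0 then 2 * n + 1 else if i ≤ n then 2 * n - 2 * i else 4 * n + 1 - 2 * i)
    (fun i => if i + 2 ≤ n then 2 * n - 2 - 2 * i else
      if i + 2 ≤ 2 * n then 4 * n - 1 - 2 * i else 0)
    (by omega) (by omega) ?_ ?_ ?_ ?_ ?_ ?_ ?_ ?_ ?_ ?_ ?_
  · intro i hi; split_ifs <;> omega
  · intro i hi; split_ifs <;> omega
  · intro i hi j hj; split_ifs <;> omega
  · intro i hi j hj; split_ifs <;> omega
  · intro i hi; split_ifs <;> omega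
  · intro i hi; split_ifs <;> omega
  · intro i hi j hj; split_ifs <;> omega
  · intro i hi j hj; split_ifs <;> omega
  · intro i hi; split_ifs <;> omega
  · intro i hi
    refine ⟨if i = 0 then n - 1 else if i < n then i - 1 else if i = n then 2 * n - 1 else i - 1,
      ?_, ?_⟩ <;> split_ifs <;> omega
  · intro i hi
    refine ⟨if i = 0 then 2 * n - 2 else if i = 1 then 2 * n - 1 else i - 2,
      ?_, ?_⟩ <;> split_ifs <;> omega

theorem stmt_7 (k : ℕ) (hk : 3 ≤ k) :
    (∃ T T' : Finset (ℕ × ℕ × ℕ),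
      IsHomogeneousLatinBitrade k T T' ∧ T.card = k * (k + 2)) ∧
    (∃ T T' : Finset (ℕ × ℕ × ℕ),
      IsHomogeneousLatinBitrade k T T' ∧ T.card = k * (k + 4)) := by
  obtain ⟨n, rfl | rfl⟩ := Nat.even_or_odd' k
  · exact ⟨even_case n _ (by omega) (by omega), even_case n _ (by omega) (by omega)⟩
  · exact ⟨odd_case n _ (by omega) (by omega), odd_case n _ (by omega) (by omega)⟩
end

section
/- Let k ≥ 3 be an integer. If for every integer m with k+5 ≤ m < 3k/2 there exists a k-homogeneous Latin bitrade of volume k·m, then for every integer m ≥ k there exists a k-homogeneous Latin bitrade of volume k·m. -/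
/-- residue of an integer modulo `m`, as a natural number -/
def rs (m : ℕ) (x : ℤ) : ℕ := (x % (m : ℤ)).toNat

lemma dv {m x y : ℤ} (h : m ∣ x) (e : y = x) : m ∣ y := e ▸ h

lemma dvn {m x y : ℤ} (h : m ∣ x) (e : y = -x) : m ∣ y := e ▸ (dvd_neg.2 h)

lemma rs_lt {m : ℕ} (hm : 0 < m) (x : ℤ) : rs m x < m := by
  unfold rs
  have h1 := Int.emod_nonneg x (b := (m : ℤ)) (by omega)
  have h2 := Int.emod_lt_of_pos x (b := (m : ℤ)) (by omega)
  omega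

lemma rs_cast {m : ℕ} (hm : 0 < m) (x : ℤ) : ((rs m x : ℕ) : ℤ) = x % (m : ℤ) := by
  unfold rs
  have h1 := Int.emod_nonneg x (b := (m : ℤ)) (by omega)
  omega

lemma rs_eq {m : ℕ} (hm : 0 < m) (x y : ℤ) : rs m x = rs m y ↔ (m : ℤ) ∣ x - y := by
  rw [← Nat.cast_inj (R := ℤ), rs_cast hm, rs_cast hm, Int.emod_eq_emod_iff_emod_sub_eq_zero]
  exact ⟨Int.dvd_of_emod_eq_zero, Int.emod_eq_zero_of_dvd⟩

lemma rs_dvd {m : ℕ} (hm : 0 < m) (x : ℤ) : (m : ℤ) ∣ (rs m x : ℤ) - x := by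
  rw [rs_cast hm]
  exact ⟨-(x / m), by have := Int.emod_add_mul_ediv x m; linarith⟩

lemma rs_self {m r : ℕ} (h : r < m) : rs m (r : ℤ) = r := by
  unfold rs
  rw [Int.emod_eq_of_lt (by omega) (by omega)]
  simp

/-- the triple generated from row `r` and offset `a` -/
def tr (m : ℕ) (f : ℤ → ℤ) (r : ℕ) (a : ℤ) : ℕ × ℕ × ℕ :=
  (r, rs m (r + a), rs m (r - f a))

/-- cyclically generated array -/
def cyc (m : ℕ) (A : Finset ℤ) (f : ℤ → ℤ) : Finset (ℕ × ℕ × ℕ) :=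
  (Finset.range m ×ˢ A).image (fun p => tr m f p.1 p.2)

lemma mem_cyc {m : ℕ} {A : Finset ℤ} {f : ℤ → ℤ} {x : ℕ × ℕ × ℕ} :
    x ∈ cyc m A f ↔ ∃ r < m, ∃ a ∈ A, tr m f r a = x := by
  unfold cyc
  simp only [Finset.mem_image, Finset.mem_product, Finset.mem_range, Prod.exists]
  constructor
  · rintro ⟨r, a, ⟨h1, h2⟩, h3⟩; exact ⟨r, h1, a, h2, h3⟩
  · rintro ⟨r, h1, a, h2, h3⟩; exact ⟨r, a, ⟨h1, h2⟩, h3⟩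

/-- the injectivity requirements on the starter -/
structure Good (m : ℕ) (A : Finset ℤ) (f : ℤ → ℤ) : Prop where
  hA : ∀ a ∈ A, ∀ b ∈ A, (m : ℤ) ∣ a - b → a = b
  hf : ∀ a ∈ A, ∀ b ∈ A, (m : ℤ) ∣ f a - f b → a = b
  hs : ∀ a ∈ A, ∀ b ∈ A, (m : ℤ) ∣ (a + f a) - (b + f b) → a = b

lemma row_eq {m r s : ℕ} (hr : r < m) (hs : s < m) (h : (m : ℤ) ∣ (r : ℤ) - s) : r = s := by
  rw [← rs_self hr, ← rs_self hs, rs_eq (by omega)]; exact h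

lemma cyc_pls {m : ℕ} (hm : 0 < m) {A : Finset ℤ} {f : ℤ → ℤ} (H : Good m A f) :
    IsPartialLatinSquare (cyc m A f) := by
  refine ⟨?_, ?_, ?_⟩
  · intro x hx y hy
    obtain ⟨r, hr, a, ha, rfl⟩ := mem_cyc.1 hx
    obtain ⟨s, hs, b, hb, rfl⟩ := mem_cyc.1 hy
    simp only [tr]
    rintro rfl h
    rw [rs_eq hm] at h
    rw [H.hA a ha b hb (by convert h using 1; ring)]
  · intro x hx y hy
    obtain ⟨r, hr, a, ha, rfl⟩ := mem_cyc.1 hx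
    obtain ⟨s, hs, b, hb, rfl⟩ := mem_cyc.1 hy
    simp only [tr]
    rintro rfl h
    rw [rs_eq hm] at h
    rw [H.hf a ha b hb (dvn h (by ring))]
  · intro x hx y hy
    obtain ⟨r, hr, a, ha, rfl⟩ := mem_cyc.1 hx
    obtain ⟨s, hs, b, hb, rfl⟩ := mem_cyc.1 hy
    simp only [tr]
    intro h1 h2
    rw [rs_eq hm] at h1 h2
    have hab := H.hs a ha b hb (dv (dvd_sub h1 h2) (by ring))
    subst hab
    have := row_eq hr hs (by convert h1 using 1; ring)
    subst this
    rfl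

lemma cyc_sub {m : ℕ} (hm : 0 < m) {A : Finset ℤ} {f g : ℤ → ℤ}
    (hB : A.image f = A.image g)
    (hS : A.image (fun a => a + f a) = A.image (fun a => a + g a)) :
    (∀ r c, (∃ e, (r, c, e) ∈ cyc m A f) → (∃ e, (r, c, e) ∈ cyc m A g)) ∧
    (∀ r e, (∃ c, (r, c, e) ∈ cyc m A f) → (∃ c, (r, c, e) ∈ cyc m A g)) ∧
    (∀ c e, (∃ r, (r, c, e) ∈ cyc m A f) → (∃ r, (r, c, e) ∈ cyc m A g)) := by
  refine ⟨?_, ?_, ?_⟩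
  · rintro r c ⟨e, h⟩
    obtain ⟨r', hr, a, ha, h⟩ := mem_cyc.1 h
    simp only [tr, Prod.mk.injEq] at h
    obtain ⟨rfl, rfl, rfl⟩ := h
    exact ⟨_, mem_cyc.2 ⟨_, hr, a, ha, rfl⟩⟩
  · rintro r e ⟨c, h⟩
    obtain ⟨r', hr, a, ha, h⟩ := mem_cyc.1 h
    simp only [tr, Prod.mk.injEq] at h
    obtain ⟨rfl, rfl, rfl⟩ := h
    have : f a ∈ A.image g := hB ▸ Finset.mem_image_of_mem f ha
    obtain ⟨b, hb, hab⟩ := Finset.mem_image.1 this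
    refine ⟨rs m (r' + b), mem_cyc.2 ⟨_, hr, b, hb, ?_⟩⟩
    simp [tr, hab]
  · rintro c e ⟨r, h⟩
    obtain ⟨r', hr, a, ha, h⟩ := mem_cyc.1 h
    simp only [tr, Prod.mk.injEq] at h
    obtain ⟨rfl, rfl, rfl⟩ := h
    have : a + f a ∈ A.image (fun a => a + g a) :=
      hS ▸ Finset.mem_image_of_mem (fun a => a + f a) ha
    obtain ⟨b, hb, hab⟩ := Finset.mem_image.1 this
    refine ⟨rs m (r' + a - b), mem_cyc.2 ⟨rs m (r' + a - b), rs_lt hm _, b, hb, ?_⟩⟩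
    have h := rs_dvd hm (r' + a - b)
    simp only [tr, Prod.mk.injEq, true_and]
    rw [rs_eq hm, rs_eq hm]
    constructor
    · convert h using 1; ring
    · exact dv h (by linarith)

lemma cyc_card {m : ℕ} (hm : 0 < m) {A : Finset ℤ} {f : ℤ → ℤ} (H : Good m A f) :
    (cyc m A f).card = A.card * m := by
  unfold cyc
  rw [Finset.card_image_of_injOn, Finset.card_product, Finset.card_range, mul_comm]
  rintro ⟨r, a⟩ h1 ⟨s, b⟩ h2 h
  simp only [Finset.coe_product, Set.mem_prod, Finset.mem_coe] at h1 h2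
  simp only [tr, Prod.mk.injEq] at h
  obtain ⟨rfl, h, -⟩ := h
  rw [rs_eq hm] at h
  rw [H.hA a h1.2 b h2.2 (by convert h using 1; ring)]

lemma cyc_hom {m : ℕ} (hm : 0 < m) {A : Finset ℤ} {f : ℤ → ℤ} (H : Good m A f) :
    (∀ r, (∃ x ∈ cyc m A f, x.1 = r) →
      ((cyc m A f).filter (fun x => x.1 = r)).card = A.card) ∧
    (∀ c, (∃ x ∈ cyc m A f, x.2.1 = c) →
      ((cyc m A f).filter (fun x => x.2.1 = c)).card = A.card) ∧
    (∀ e, (∃ x ∈ cyc m A f, x.2.2 = e) →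
      ((cyc m A f).filter (fun x => x.2.2 = e)).card = A.card) := by
  refine ⟨?_, ?_, ?_⟩
  · rintro r ⟨x, hx, rfl⟩
    obtain ⟨r, hr, a0, ha0, rfl⟩ := mem_cyc.1 hx
    symm
    apply Finset.card_bij (fun a _ => tr m f r a)
    · intro a ha
      exact Finset.mem_filter.2 ⟨mem_cyc.2 ⟨r, hr, a, ha, rfl⟩, rfl⟩
    · intro a ha b hb h
      simp only [tr, Prod.mk.injEq] at h
      have h := (rs_eq hm _ _).1 h.2.1
      exact H.hA a ha b hb (by convert h using 1; ring)
    · intro y hy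
      obtain ⟨hy, h⟩ := Finset.mem_filter.1 hy
      obtain ⟨s, hs, b, hb, rfl⟩ := mem_cyc.1 hy
      simp only [tr] at h
      subst h
      exact ⟨b, hb, rfl⟩
  · rintro c ⟨x, hx, rfl⟩
    obtain ⟨r, hr, a0, ha0, rfl⟩ := mem_cyc.1 hx
    symm
    apply Finset.card_bij (fun a _ => tr m f (rs m (r + a0 - a)) a)
    · intro a ha
      refine Finset.mem_filter.2 ⟨mem_cyc.2 ⟨_, rs_lt hm _, a, ha, rfl⟩, ?_⟩
      simp only [tr]
      rw [rs_eq hm]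
      convert rs_dvd hm (r + a0 - a) using 1; ring
    · intro a ha b hb h
      simp only [tr, Prod.mk.injEq] at h
      have h := (rs_eq hm _ _).1 h.1
      exact H.hA a ha b hb (dvn h (by ring))
    · intro y hy
      obtain ⟨hy, h⟩ := Finset.mem_filter.1 hy
      obtain ⟨s, hs, b, hb, rfl⟩ := mem_cyc.1 hy
      simp only [tr] at h
      rw [rs_eq hm] at h
      refine ⟨b, hb, ?_⟩
      have : rs m (r + a0 - b) = s := by
        rw [← rs_self hs, rs_eq hm]
        exact dvn h (by ring)
      rw [this]
  · rintro c ⟨x, hx, rfl⟩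
    obtain ⟨r, hr, a0, ha0, rfl⟩ := mem_cyc.1 hx
    symm
    apply Finset.card_bij (fun a _ => tr m f (rs m (r - f a0 + f a)) a)
    · intro a ha
      refine Finset.mem_filter.2 ⟨mem_cyc.2 ⟨_, rs_lt hm _, a, ha, rfl⟩, ?_⟩
      simp only [tr]
      rw [rs_eq hm]
      convert rs_dvd hm (r - f a0 + f a) using 1; ring
    · intro a ha b hb h
      simp only [tr, Prod.mk.injEq] at h
      have h := (rs_eq hm _ _).1 h.1
      exact H.hf a ha b hb (by convert h using 1; ring)
    · intro y hy
      obtain ⟨hy, h⟩ := Finset.mem_filter.1 hy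
      obtain ⟨s, hs, b, hb, rfl⟩ := mem_cyc.1 hy
      simp only [tr] at h
      rw [rs_eq hm] at h
      refine ⟨b, hb, ?_⟩
      have : rs m (r - f a0 + f b) = s := by
        rw [← rs_self hs, rs_eq hm]
        exact dvn h (by ring)
      rw [this]

lemma cyc_bitrade {m : ℕ} (hm : 0 < m) {A : Finset ℤ} {f g : ℤ → ℤ} (H : Good m A f)
    (H' : Good m A g) (hB : A.image f = A.image g)
    (hS : A.image (fun a => a + f a) = A.image (fun a => a + g a))
    (hd : ∀ a ∈ A, ¬ (m : ℤ) ∣ f a - g a) :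
    ∃ T T' : Finset (ℕ × ℕ × ℕ),
      IsHomogeneousLatinBitrade A.card T T' ∧ T.card = A.card * m := by
  refine ⟨cyc m A f, cyc m A g, ⟨⟨cyc_pls hm H, cyc_pls hm H', ?_, ?_, ?_, ?_⟩, cyc_hom hm H⟩,
    cyc_card hm H⟩
  · rw [Finset.disjoint_left]
    intro x hx hy
    obtain ⟨r, hr, a, ha, rfl⟩ := mem_cyc.1 hx
    obtain ⟨s, hs, b, hb, h⟩ := mem_cyc.1 hy
    simp only [tr, Prod.mk.injEq] at h
    obtain ⟨rfl, h1, h2⟩ := h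
    rw [rs_eq hm] at h1 h2
    have := H.hA b hb a ha (by convert h1 using 1; ring)
    subst this
    exact hd b ha (by convert h2 using 1; ring)
  · exact fun r c => ⟨(cyc_sub hm hB hS).1 r c, (cyc_sub hm hB.symm hS.symm).1 r c⟩
  · exact fun r c => ⟨(cyc_sub hm hB hS).2.1 r c, (cyc_sub hm hB.symm hS.symm).2.1 r c⟩
  · exact fun r c => ⟨(cyc_sub hm hB hS).2.2 r c, (cyc_sub hm hB.symm hS.symm).2.2 r c⟩

/-- `f` permutes `[-L, L]` and so does `a ↦ a + f a`. -/
structure Sol (L : ℤ) (f : ℤ → ℤ) : Prop where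
  b1 : ∀ a, -L ≤ a → a ≤ L → -L ≤ f a ∧ f a ≤ L
  b2 : ∀ a, -L ≤ a → a ≤ L → -L ≤ a + f a ∧ a + f a ≤ L
  i1 : ∀ a b, -L ≤ a → a ≤ L → -L ≤ b → b ≤ L → f a = f b → a = b
  i2 : ∀ a b, -L ≤ a → a ≤ L → -L ≤ b → b ≤ L → a + f a = b + f b → a = b

lemma dvd_small {m : ℕ} {L x y : ℤ} (h : 2 * L + 1 ≤ m) (hx : -L ≤ x ∧ x ≤ L)
    (hy : -L ≤ y ∧ y ≤ L) (hd : (m : ℤ) ∣ x - y) : x = y := by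
  have := Int.eq_zero_of_abs_lt_dvd hd (by rw [abs_lt]; constructor <;> omega)
  omega

lemma Sol.good {L : ℤ} {f : ℤ → ℤ} (H : Sol L f) {m : ℕ} (h : 2 * L + 1 ≤ m) {A : Finset ℤ}
    (hA : A ⊆ Finset.Icc (-L) L) : Good m A f := by
  have hA' : ∀ a ∈ A, -L ≤ a ∧ a ≤ L := fun a ha => Finset.mem_Icc.1 (hA ha)
  refine ⟨?_, ?_, ?_⟩
  · intro a ha b hb hd
    exact dvd_small h (hA' a ha) (hA' b hb) hd
  · intro a ha b hb hd
    obtain ⟨a1, a2⟩ := hA' a ha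
    obtain ⟨b1, b2⟩ := hA' b hb
    exact H.i1 a b a1 a2 b1 b2 (dvd_small h (H.b1 a a1 a2) (H.b1 b b1 b2) hd)
  · intro a ha b hb hd
    obtain ⟨a1, a2⟩ := hA' a ha
    obtain ⟨b1, b2⟩ := hA' b hb
    exact H.i2 a b a1 a2 b1 b2 (dvd_small h (H.b2 a a1 a2) (H.b2 b b1 b2) hd)

lemma image_perm {L : ℤ} {f : ℤ → ℤ} (b1 : ∀ a, -L ≤ a → a ≤ L → -L ≤ f a ∧ f a ≤ L)
    (i1 : ∀ a b, -L ≤ a → a ≤ L → -L ≤ b → b ≤ L → f a = f b → a = b) :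
    (Finset.Icc (-L) L).image f = Finset.Icc (-L) L := by
  apply Finset.eq_of_subset_of_card_le
  · intro x hx
    obtain ⟨a, ha, rfl⟩ := Finset.mem_image.1 hx
    rw [Finset.mem_Icc] at *
    exact b1 a ha.1 ha.2
  · rw [Finset.card_image_of_injOn]
    intro a ha b hb h
    simp only [Finset.coe_Icc, Set.mem_Icc] at ha hb
    exact i1 a b ha.1 ha.2 hb.1 hb.2 h

lemma image_perm_erase {L : ℤ} {f : ℤ → ℤ} (b1 : ∀ a, -L ≤ a → a ≤ L → -L ≤ f a ∧ f a ≤ L)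
    (i1 : ∀ a b, -L ≤ a → a ≤ L → -L ≤ b → b ≤ L → f a = f b → a = b) {p : ℤ}
    (h1 : -L ≤ p) (h2 : p ≤ L) :
    ((Finset.Icc (-L) L).erase p).image f = (Finset.Icc (-L) L).erase (f p) := by
  conv_rhs => rw [← image_perm b1 i1]
  ext y
  simp only [Finset.mem_image, Finset.mem_erase, Finset.mem_Icc]
  constructor
  · rintro ⟨a, ⟨h, ha, hb⟩, rfl⟩
    exact ⟨fun e => h (i1 a p ha hb h1 h2 e), a, ⟨ha, hb⟩, rfl⟩
  · rintro ⟨h, a, ⟨ha, hb⟩, rfl⟩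
    exact ⟨a, ⟨fun e => h (e ▸ rfl), ha, hb⟩, rfl⟩

/-- Two solutions without common point. -/
def Dis (L : ℤ) (f g : ℤ → ℤ) : Prop := ∀ a, -L ≤ a → a ≤ L → f a ≠ g a

/-- Two solutions with exactly one common point. -/
def Meet1 (L : ℤ) (f g : ℤ → ℤ) : Prop :=
  ∃ p, -L ≤ p ∧ p ≤ L ∧ f p = g p ∧ ∀ a, -L ≤ a → a ≤ L → a ≠ p → f a ≠ g a

lemma dis_bitrade {L : ℕ} {f g : ℤ → ℤ} (hf : Sol L f) (hg : Sol L g) (h : Dis L f g) {m : ℕ}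
    (hm : 2 * L + 1 ≤ m) :
    ∃ T T' : Finset (ℕ × ℕ × ℕ),
      IsHomogeneousLatinBitrade (2 * L + 1) T T' ∧ T.card = (2 * L + 1) * m := by
  have hm' : 2 * (L : ℤ) + 1 ≤ m := by omega
  have hc : (Finset.Icc (-(L : ℤ)) L).card = 2 * L + 1 := by
    rw [Int.card_Icc]; omega
  have := cyc_bitrade (m := m) (by omega) (hf.good hm' (Finset.Subset.refl _))
    (hg.good hm' (Finset.Subset.refl _))
    (by rw [image_perm hf.b1 hf.i1, image_perm hg.b1 hg.i1])
    (by rw [image_perm hf.b2 hf.i2, image_perm hg.b2 hg.i2])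
    (by
      intro a ha hd
      rw [Finset.mem_Icc] at ha
      exact h a ha.1 ha.2 (dvd_small hm' (hf.b1 a ha.1 ha.2) (hg.b1 a ha.1 ha.2) hd))
  rwa [hc] at this

lemma one_bitrade {L : ℕ} {f g : ℤ → ℤ} (hf : Sol L f) (hg : Sol L g) (h : Meet1 L f g) {m : ℕ}
    (hm : 2 * L + 1 ≤ m) :
    ∃ T T' : Finset (ℕ × ℕ × ℕ),
      IsHomogeneousLatinBitrade (2 * L) T T' ∧ T.card = (2 * L) * m := by
  obtain ⟨p, p1, p2, hp, h⟩ := h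
  have hm' : 2 * (L : ℤ) + 1 ≤ m := by omega
  have hc : ((Finset.Icc (-(L : ℤ)) L).erase p).card = 2 * L := by
    rw [Finset.card_erase_of_mem (Finset.mem_Icc.2 ⟨p1, p2⟩), Int.card_Icc]; omega
  have := cyc_bitrade (m := m) (by omega) (hf.good hm' (Finset.erase_subset p _))
    (hg.good hm' (Finset.erase_subset p _))
    (by rw [image_perm_erase hf.b1 hf.i1 p1 p2, image_perm_erase hg.b1 hg.i1 p1 p2, hp])
    (by rw [image_perm_erase hf.b2 hf.i2 p1 p2, image_perm_erase hg.b2 hg.i2 p1 p2, hp])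
    (by
      intro a ha hd
      rw [Finset.mem_erase, Finset.mem_Icc] at ha
      obtain ⟨h0, h1, h2⟩ := ha
      exact h a h1 h2 h0 (dvd_small hm' (hf.b1 a h1 h2) (hg.b1 a h1 h2) hd))
  rwa [hc] at this

/-- the basic linear solution -/
def lin (L a : ℤ) : ℤ := if (a + L) % 2 = 0 then -((a + L) / 2) else L - (a + L - 1) / 2

/-- the conjugate -/
def lin' (L a : ℤ) : ℤ := -(a + lin L a)

/-- the inverse of the basic solution -/
def linv (L a : ℤ) : ℤ := if a ≤ 0 then -2 * a - L else L + 1 - 2 * a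

lemma lin_sol (L : ℤ) : Sol L (lin L) := by
  constructor <;> intros <;> simp only [lin] at * <;> split_ifs at * <;> omega

lemma lin'_sol (L : ℤ) : Sol L (lin' L) := by
  constructor <;> intros <;> simp only [lin, lin'] at * <;> split_ifs at * <;> omega

lemma linv_sol (L : ℤ) : Sol L (linv L) := by
  constructor <;> intros <;> simp only [linv] at * <;> split_ifs at * <;> omega

lemma lin_dis (L : ℤ) (hL : 1 ≤ L) : Dis L (lin L) (lin' L) := by
  intro a h1 h2 h
  simp only [lin, lin'] at *
  split_ifs at * <;> omega

lemma lin_one (L : ℤ) (hL : 2 ≤ L) (h3 : L % 3 ≠ 1) : Meet1 L (lin L) (linv L) := by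
  by_cases h0 : L % 3 = 0
  · refine ⟨-(L / 3), by omega, by omega, ?_, ?_⟩
    · simp only [lin, linv]; split_ifs <;> omega
    · intro a h1 h2 h4 h
      simp only [lin, linv] at h; split_ifs at h <;> omega
  · refine ⟨(L + 1) / 3, by omega, by omega, ?_, ?_⟩
    · simp only [lin, linv]; split_ifs <;> omega
    · intro a h1 h2 h4 h
      simp only [lin, linv] at h; split_ifs at h <;> omega

/-- blow-up of the three point solution -/
def blow (p : ℤ) (u v w : ℤ → ℤ) (a : ℤ) : ℤ :=
  if a < -p then u (a + (2 * p + 1))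
  else if a ≤ p then (2 * p + 1) + v a
  else -(2 * p + 1) + w (a - (2 * p + 1))

lemma blow_cases {p : ℤ} (u v w : ℤ → ℤ) {a : ℤ} (h1 : -(3 * p + 1) ≤ a) (h2 : a ≤ 3 * p + 1) :
    (∃ x, -p ≤ x ∧ x ≤ p ∧ a = x - (2 * p + 1) ∧ blow p u v w a = u x) ∨
    (∃ x, -p ≤ x ∧ x ≤ p ∧ a = x ∧ blow p u v w a = (2 * p + 1) + v x) ∨
    (∃ x, -p ≤ x ∧ x ≤ p ∧ a = x + (2 * p + 1) ∧ blow p u v w a = -(2 * p + 1) + w x) := by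
  by_cases c1 : a < -p
  · left
    exact ⟨a + (2 * p + 1), by omega, by omega, by omega, by simp [blow, c1]⟩
  · right
    by_cases c2 : a ≤ p
    · left
      exact ⟨a, by omega, by omega, by omega, by simp [blow, c1, c2]⟩
    · right
      exact ⟨a - (2 * p + 1), by omega, by omega, by omega, by simp [blow, c1, c2]⟩

lemma blow_sol {p : ℤ} {u v w : ℤ → ℤ} (hu : Sol p u) (hv : Sol p v) (hw : Sol p w) :
    Sol (3 * p + 1) (blow p u v w) := by
  constructor
  · intro a h1 h2
    rcases blow_cases u v w h1 h2 with ⟨x, x1, x2, ea, e⟩ | ⟨x, x1, x2, ea, e⟩ | ⟨x, x1, x2, ea, e⟩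
    · have := hu.b1 x x1 x2; omega
    · have := hv.b1 x x1 x2; omega
    · have := hw.b1 x x1 x2; omega
  · intro a h1 h2
    rcases blow_cases u v w h1 h2 with ⟨x, x1, x2, ea, e⟩ | ⟨x, x1, x2, ea, e⟩ | ⟨x, x1, x2, ea, e⟩
    · have := hu.b2 x x1 x2; omega
    · have := hv.b2 x x1 x2; omega
    · have := hw.b2 x x1 x2; omega
  · intro a b h1 h2 h3 h4 h
    rcases blow_cases u v w h1 h2 with ⟨x, x1, x2, ea, e⟩ | ⟨x, x1, x2, ea, e⟩ | ⟨x, x1, x2, ea, e⟩ <;>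
    rcases blow_cases u v w h3 h4 with ⟨y, y1, y2, eb, e'⟩ | ⟨y, y1, y2, eb, e'⟩ | ⟨y, y1, y2, eb, e'⟩
    all_goals
      have a1 := hu.b1 x x1 x2
      have a2 := hv.b1 x x1 x2
      have a3 := hw.b1 x x1 x2
      have b1 := hu.b1 y y1 y2
      have b2 := hv.b1 y y1 y2
      have b3 := hw.b1 y y1 y2
      have c1 := hu.i1 x y x1 x2 y1 y2
      have c2 := hv.i1 x y x1 x2 y1 y2
      have c3 := hw.i1 x y x1 x2 y1 y2
      rw [e, e'] at h
      omega
  · intro a b h1 h2 h3 h4 h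
    rcases blow_cases u v w h1 h2 with ⟨x, x1, x2, ea, e⟩ | ⟨x, x1, x2, ea, e⟩ | ⟨x, x1, x2, ea, e⟩ <;>
    rcases blow_cases u v w h3 h4 with ⟨y, y1, y2, eb, e'⟩ | ⟨y, y1, y2, eb, e'⟩ | ⟨y, y1, y2, eb, e'⟩
    all_goals
      have a1 := hu.b2 x x1 x2
      have a2 := hv.b2 x x1 x2
      have a3 := hw.b2 x x1 x2
      have b1 := hu.b2 y y1 y2
      have b2 := hv.b2 y y1 y2
      have b3 := hw.b2 y y1 y2
      have c1 := hu.i2 x y x1 x2 y1 y2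
      have c2 := hv.i2 x y x1 x2 y1 y2
      have c3 := hw.i2 x y x1 x2 y1 y2
      rw [e, e'] at h
      omega

lemma blow_one {p : ℤ} {u v w u' v' w' : ℤ → ℤ} (hu : Dis p u u') (hv : Meet1 p v v')
    (hw : Dis p w w') : Meet1 (3 * p + 1) (blow p u v w) (blow p u' v' w') := by
  obtain ⟨q, q1, q2, e, hq⟩ := hv
  refine ⟨q, by omega, by omega, ?_, ?_⟩
  · have : ¬ q < -p := by omega
    simp [blow, this, q2, e]
  · intro a h1 h2 hne h
    have h2' : a ≤ 3 * p + 1 := h2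
    unfold blow at h
    split_ifs at h with c1 c2
    · exact hu _ (by omega) (by omega) h
    · exact hq a (by omega) c2 hne (by omega)
    · exact hw _ (by omega) (by omega) (add_left_cancel h)

/-- first solution for nine points -/
def nineA (a : ℤ) : ℤ :=
  if a = -4 then 0 else if a = -3 then 2 else if a = -2 then -1 else if a = -1 then 3
  else if a = 0 then 4 else if a = 1 then -3 else if a = 2 then 1 else if a = 3 then -2 else -4

/-- second solution for nine points -/
def nineB (a : ℤ) : ℤ :=
  if a = -4 then 0 else if a = -3 then 1 else if a = -2 then 2 else if a = -1 then 4
  else if a = 0 then -3 else if a = 1 then 3 else if a = 2 then -1 else if a = 3 then -4 else -2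

lemma sol_of_decide {L : ℤ} {f : ℤ → ℤ}
    (h1 : ∀ a ∈ Finset.Icc (-L) L, (-L ≤ f a ∧ f a ≤ L) ∧ (-L ≤ a + f a ∧ a + f a ≤ L))
    (h2 : ∀ a ∈ Finset.Icc (-L) L, ∀ b ∈ Finset.Icc (-L) L,
      (f a = f b → a = b) ∧ (a + f a = b + f b → a = b)) : Sol L f := by
  refine ⟨fun a p q => (h1 a ?_).1, fun a p q => (h1 a ?_).2,
    fun a b p q r s => (h2 a ?_ b ?_).1, fun a b p q r s => (h2 a ?_ b ?_).2⟩ <;>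
  simp [*]

lemma nineA_sol : Sol 4 nineA := sol_of_decide (by decide) (by decide)

lemma nineB_sol : Sol 4 nineB := sol_of_decide (by decide) (by decide)

lemma nine_one : Meet1 4 nineA nineB := by
  refine ⟨-4, by omega, by omega, by decide, ?_⟩
  intro a h1 h2 h3 h
  have : ∀ a ∈ Finset.Icc (-4 : ℤ) 4, a ≠ -4 → nineA a ≠ nineB a := by decide
  exact this a (by simp [*]) h3 h

lemma exists_one (L : ℕ) : 2 ≤ L → ∃ f g, Sol L f ∧ Sol L g ∧ Meet1 L f g := by
  induction L using Nat.strong_induction_on with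
  | _ L ih =>
    intro hL
    by_cases h3 : L % 3 = 1
    · by_cases h4 : L = 4
      · subst h4
        exact ⟨nineA, nineB, nineA_sol, nineB_sol, nine_one⟩
      · obtain ⟨p, rfl⟩ : ∃ p, L = 3 * p + 1 := ⟨L / 3, by omega⟩
        obtain ⟨f, g, hf, hg, h⟩ := ih p (by omega) (by omega)
        have hd := lin_dis (p : ℤ) (by omega)
        push_cast
        exact ⟨_, _, blow_sol (lin_sol p) hf (lin_sol p), blow_sol (lin'_sol p) hg (lin'_sol p),
          blow_one hd h hd⟩
    · exact ⟨_, _, lin_sol L, linv_sol L, lin_one L (by omega) (by omega)⟩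

/-- cyclic Latin square of order `k` shifted by `s` -/
def sqr (k s : ℕ) : Finset (ℕ × ℕ × ℕ) :=
  (Finset.range k ×ˢ Finset.range k).image (fun p => (p.1, p.2, (p.1 + p.2 + s) % k))

lemma mem_sq {k s r c e : ℕ} :
    (r, c, e) ∈ sqr k s ↔ r < k ∧ c < k ∧ e = (r + c + s) % k := by
  unfold sqr
  simp only [Finset.mem_image, Finset.mem_product, Finset.mem_range, Prod.exists, Prod.mk.injEq]
  constructor
  · rintro ⟨a, b, ⟨h1, h2⟩, rfl, rfl, rfl⟩; exact ⟨h1, h2, rfl⟩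
  · rintro ⟨h1, h2, rfl⟩; exact ⟨r, c, ⟨h1, h2⟩, rfl, rfl, rfl⟩

lemma mod_cancel {k x a b : ℕ} (ha : a < k) (hb : b < k) (h : (x + a) % k = (x + b) % k) :
    a = b := by
  have : a ≡ b [MOD k] := Nat.ModEq.add_left_cancel' x h
  exact Nat.ModEq.eq_of_lt_of_lt this ha hb

lemma mod_solve {k : ℕ} (x : ℕ) {e : ℕ} (he : e < k) : ∃ a < k, (x + a) % k = e := by
  have hx : x % k < k := Nat.mod_lt _ (by omega)
  refine ⟨(e + (k - x % k)) % k, Nat.mod_lt _ (by omega), ?_⟩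
  have hd := Nat.div_add_mod x k
  rw [Nat.add_mod_mod]
  rw [show x + (e + (k - x % k)) = e + k * (x / k + 1) by
    rw [mul_add, mul_one]; omega]
  rw [Nat.add_mul_mod_self_left, Nat.mod_eq_of_lt he]

lemma sq_pls (k s : ℕ) : IsPartialLatinSquare (sqr k s) := by
  refine ⟨?_, ?_, ?_⟩
  · rintro ⟨r, c, e⟩ h ⟨r', c', e'⟩ h'
    rw [mem_sq] at h h'
    simp only
    rintro rfl rfl
    rw [h.2.2, h'.2.2]
  · rintro ⟨r, c, e⟩ h ⟨r', c', e'⟩ h'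
    rw [mem_sq] at h h'
    simp only
    rintro rfl rfl
    rw [mod_cancel (k := k) (x := r + s) h.2.1 h'.2.1]
    rw [show r + s + c = r + c + s by ring, show r + s + c' = r + c' + s by ring, ← h.2.2, ← h'.2.2]
  · rintro ⟨r, c, e⟩ h ⟨r', c', e'⟩ h'
    rw [mem_sq] at h h'
    simp only
    rintro rfl rfl
    rw [mod_cancel (k := k) (x := c + s) h.1 h'.1]
    rw [show c + s + r = r + c + s by ring, show c + s + r' = r' + c + s by ring, ← h.2.2, ← h'.2.2]

lemma sq_re {k s r e : ℕ} : (∃ c, (r, c, e) ∈ sqr k s) ↔ r < k ∧ e < k := by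
  constructor
  · rintro ⟨c, h⟩
    rw [mem_sq] at h
    exact ⟨h.1, h.2.2 ▸ Nat.mod_lt _ (by omega)⟩
  · rintro ⟨h1, h2⟩
    obtain ⟨c, hc, h⟩ := mod_solve (r + s) h2
    exact ⟨c, mem_sq.2 ⟨h1, hc, by rw [← h]; congr 1; ring⟩⟩

lemma sq_ce {k s c e : ℕ} : (∃ r, (r, c, e) ∈ sqr k s) ↔ c < k ∧ e < k := by
  constructor
  · rintro ⟨r, h⟩
    rw [mem_sq] at h
    exact ⟨h.2.1, h.2.2 ▸ Nat.mod_lt _ (by omega)⟩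
  · rintro ⟨h1, h2⟩
    obtain ⟨r, hc, h⟩ := mod_solve (c + s) h2
    exact ⟨r, mem_sq.2 ⟨hc, h1, by rw [← h]; congr 1; ring⟩⟩

lemma sq_rc {k s r c : ℕ} : (∃ e, (r, c, e) ∈ sqr k s) ↔ r < k ∧ c < k := by
  constructor
  · rintro ⟨e, h⟩
    rw [mem_sq] at h
    exact ⟨h.1, h.2.1⟩
  · rintro ⟨h1, h2⟩
    exact ⟨_, mem_sq.2 ⟨h1, h2, rfl⟩⟩

lemma sq_bitrade (k : ℕ) (hk : 3 ≤ k) :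
    ∃ T T' : Finset (ℕ × ℕ × ℕ), IsHomogeneousLatinBitrade k T T' ∧ T.card = k * k := by
  refine ⟨sqr k 0, sqr k 1, ⟨⟨sq_pls k 0, sq_pls k 1, ?_, ?_, ?_, ?_⟩, ?_, ?_, ?_⟩, ?_⟩
  · rw [Finset.disjoint_left]
    rintro ⟨r, c, e⟩ h h'
    rw [mem_sq] at h h'
    have := mod_cancel (k := k) (x := r + c) (a := 0) (b := 1) (by omega) (by omega)
      (h.2.2.symm.trans h'.2.2)
    omega
  · intro r c; rw [sq_rc, sq_rc]
  · intro r c; rw [sq_re, sq_re]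
  · intro r c; rw [sq_ce, sq_ce]
  · rintro r ⟨⟨r, c, e⟩, h, rfl⟩
    have hr := (mem_sq.1 h).1
    conv_rhs => rw [← Finset.card_range k]
    symm
    apply Finset.card_bij (fun c _ => (r, c, (r + c + 0) % k))
    · intro a ha
      exact Finset.mem_filter.2 ⟨mem_sq.2 ⟨hr, Finset.mem_range.1 ha, rfl⟩, rfl⟩
    · intro a _ b _ h
      simp only [Prod.mk.injEq] at h
      exact h.2.1
    · rintro ⟨r', c', e'⟩ h'
      obtain ⟨h2, h0⟩ := Finset.mem_filter.1 h'
      clear h'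
      simp only at h0
      subst h0
      have h' := mem_sq.1 h2
      exact ⟨c', Finset.mem_range.2 h'.2.1, by rw [h'.2.2]⟩
  · rintro c ⟨⟨r, c, e⟩, h, rfl⟩
    have hr := (mem_sq.1 h).2.1
    conv_rhs => rw [← Finset.card_range k]
    symm
    apply Finset.card_bij (fun r _ => (r, c, (r + c + 0) % k))
    · intro a ha
      exact Finset.mem_filter.2 ⟨mem_sq.2 ⟨Finset.mem_range.1 ha, hr, rfl⟩, rfl⟩
    · intro a _ b _ h
      simp only [Prod.mk.injEq] at h
      exact h.1
    · rintro ⟨r', c', e'⟩ h'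
      obtain ⟨h2, h0⟩ := Finset.mem_filter.1 h'
      clear h'
      simp only at h0
      subst h0
      have h' := mem_sq.1 h2
      exact ⟨r', Finset.mem_range.2 h'.1, by rw [h'.2.2]⟩
  · rintro e ⟨⟨r, c, e⟩, h, rfl⟩
    have he : e < k := (sq_re.1 ⟨c, h⟩).2
    conv_rhs => rw [← Finset.card_range k]
    apply Finset.card_bij (fun x _ => x.1)
    · rintro ⟨r', c', e'⟩ h'
      obtain ⟨h', -⟩ := Finset.mem_filter.1 h'
      exact Finset.mem_range.2 (mem_sq.1 h').1
    · intro x hx y hy hxy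
      obtain ⟨hx, hx'⟩ := Finset.mem_filter.1 hx
      obtain ⟨hy, hy'⟩ := Finset.mem_filter.1 hy
      exact (sq_pls k 0).2.1 x hx y hy hxy (hx'.trans hy'.symm)
    · intro r' hr'
      obtain ⟨c', h'⟩ := (sq_re (s := 0)).2 ⟨Finset.mem_range.1 hr', he⟩
      exact ⟨(r', c', e), Finset.mem_filter.2 ⟨h', rfl⟩, rfl⟩
  · unfold sqr
    rw [Finset.card_image_of_injOn, Finset.card_product, Finset.card_range]
    rintro ⟨a, b⟩ _ ⟨c, d⟩ _ h
    simp only [Prod.mk.injEq] at h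
    rw [h.1, h.2.1]

theorem stmt_8 (k : ℕ) (hk : 3 ≤ k)
    (h : ∀ m : ℕ, k + 5 ≤ m → 2 * m < 3 * k →
      ∃ T T' : Finset (ℕ × ℕ × ℕ),
        IsHomogeneousLatinBitrade k T T' ∧ T.card = k * m) :
    ∀ m : ℕ, k ≤ m →
      ∃ T T' : Finset (ℕ × ℕ × ℕ),
        IsHomogeneousLatinBitrade k T T' ∧ T.card = k * m := by
  intro m hm
  rcases Nat.even_or_odd' k with ⟨L, rfl | rfl⟩
  · by_cases hmk : m = 2 * L
    · subst hmk
      exact sq_bitrade _ hk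
    · obtain ⟨f, g, hf, hg, h1⟩ := exists_one L (by omega)
      exact one_bitrade hf hg h1 (by omega)
  · exact dis_bitrade (lin_sol L) (lin'_sol L) (lin_dis L (by omega)) hm
end
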